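/- Let Δ be a base of a root system spanning a Euclidean space with Weyl-invariant inner product, and let {w_α}_{α∈Δ} be the dual weights ((w_α,β)=δ_{αβ}). Then (w_α, w_β) ≥ 0 for all α,β ∈ Δ, and if the root system is irreducible then (w_α, w_β) > 0 for all α,β ∈ Δ. -/

import Mathlib

open Finset
open scoped RealInnerProductSpace

/-- `Δ` is a base (set of simple roots) of a (reduced, crystallographic) root system `Φ`
spanning the Euclidean space `E`.  Since the reflections used here are the orthogonal
reflections with respect to the inner product, the inner product is automatically
invariant under the Weyl group. -/
structure IsRootSystemBase {E : Type*} [NormedAddCommGroup E] [InnerProductSpace ℝ E]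
    [FiniteDimensional ℝ E] (Φ : Set E) (Δ : Finset E) : Prop where
  subset : (Δ : Set E) ⊆ Φ
  span_top : Submodule.span ℝ (Δ : Set E) = ⊤
  indep : LinearIndependent ℝ (fun α : Δ => (α : E))
  ne_zero : ∀ α ∈ Φ, α ≠ (0 : E)
  reflect_mem : ∀ α ∈ Φ, ∀ β ∈ Φ, β - (2 * ⟪α, β⟫ / ⟪α, α⟫) • α ∈ Φ
  crystallographic : ∀ α ∈ Φ, ∀ β ∈ Φ, ∃ n : ℤ, 2 * ⟪α, β⟫ / ⟪α, α⟫ = (n : ℝ)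
  pos_or_neg : ∀ x ∈ Φ,
      (∃ c : E → ℝ, (∀ β ∈ Δ, 0 ≤ c β) ∧ x = ∑ β ∈ Δ, c β • β) ∨
      (∃ c : E → ℝ, (∀ β ∈ Δ, 0 ≤ c β) ∧ x = -∑ β ∈ Δ, c β • β)

/-- The root system `Φ` with base `Δ` is irreducible: `Δ` cannot be split into two
nonempty mutually orthogonal pieces. -/
def IsIrreducibleBase {E : Type*} [NormedAddCommGroup E] [InnerProductSpace ℝ E] [DecidableEq E]
    (Δ : Finset E) : Prop :=
  ∀ s ⊆ Δ, s.Nonempty → s ≠ Δ → ∃ α ∈ s, ∃ β ∈ Δ \ s, ⟪α, β⟫ ≠ (0 : ℝ)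

/-- `(w_α, w_β) ≥ 0` for all `α, β ∈ Δ`, and if the root system is irreducible then
`(w_α, w_β) > 0` for all `α, β ∈ Δ`. -/
theorem dual_weights_inner_nonneg_and_pos_of_irreducible
    {E : Type*} [NormedAddCommGroup E] [InnerProductSpace ℝ E] [FiniteDimensional ℝ E]
    [DecidableEq E] (Φ : Set E) (Δ : Finset E) (hbase : IsRootSystemBase Φ Δ)
    (w : E → E) (hw : ∀ α ∈ Δ, ∀ β ∈ Δ, ⟪w α, β⟫ = if α = β then (1 : ℝ) else 0) :
    (∀ α ∈ Δ, ∀ β ∈ Δ, 0 ≤ ⟪w α, w β⟫) ∧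
    (IsIrreducibleBase Δ → ∀ α ∈ Δ, ∀ β ∈ Δ, 0 < ⟪w α, w β⟫) := by
  have key : ∀ (c : E → ℝ), ∀ δ ∈ Δ, ⟪w δ, ∑ β ∈ Δ, c β • β⟫ = c δ := by
    intro c δ hδ
    rw [inner_sum, Finset.sum_eq_single δ]
    · rw [inner_smul_right, hw δ hδ δ hδ]; simp
    · intro b hb hne
      rw [inner_smul_right, hw δ hδ b hb, if_neg (Ne.symm hne)]; simp
    · intro h; exact absurd hδ h
  -- simple roots are pairwise obtuse
  have obt : ∀ α ∈ Δ, ∀ β ∈ Δ, α ≠ β → ⟪α, β⟫ ≤ (0 : ℝ) := by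
    intro α hα β hβ hne
    have hαΦ := hbase.subset hα
    have hm := hbase.reflect_mem α hαΦ β (hbase.subset hβ)
    have hpos : 0 < ⟪α, α⟫ := real_inner_self_pos.2 (hbase.ne_zero α hαΦ)
    set k : ℝ := 2 * ⟪α, β⟫ / ⟪α, α⟫ with hk
    have h1 : ⟪w β, β - k • α⟫ = 1 := by
      rw [inner_sub_right, inner_smul_right, hw β hβ β hβ, hw β hβ α hα, if_neg hne.symm]; simp
    have h2 : ⟪w α, β - k • α⟫ = -k := by
      rw [inner_sub_right, inner_smul_right, hw α hα β hβ, hw α hα α hα, if_neg hne]; simp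
    rcases hbase.pos_or_neg _ hm with ⟨c, hc, hx⟩ | ⟨c, hc, hx⟩
    · rw [hx, key c α hα] at h2
      have h3 := hc α hα
      by_contra hcon
      push Not at hcon
      have : 0 < k := by rw [hk]; positivity
      linarith
    · rw [hx, inner_neg_right, key c β hβ] at h1
      have := hc β hβ
      linarith
  have expand : ∀ v : E, v = ∑ β ∈ Δ, ⟪w β, v⟫ • β := by
    intro v
    have hv : v ∈ Submodule.span ℝ (Δ : Set E) := by rw [hbase.span_top]; trivial
    obtain ⟨c, -, hc⟩ := Submodule.mem_span_finset.1 hv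
    calc v = ∑ β ∈ Δ, c β • β := hc.symm
      _ = _ := by
        apply Finset.sum_congr rfl
        intro β hβ
        rw [← hc, key c β hβ]
  have wpair : ∀ α ∈ Δ, ∀ β ∈ Δ, 0 ≤ ⟪w α, β⟫ := by
    intro α hα β hβ
    rw [hw α hα β hβ]
    split_ifs <;> norm_num
  have nonneg : ∀ α ∈ Δ, ∀ β ∈ Δ, 0 ≤ ⟪w α, w β⟫ := by
    intro α hα β hβ
    set n : E := ∑ γ ∈ Δ, (max (-⟪w γ, w α⟫) 0) • γ with hn
    set p : E := ∑ γ ∈ Δ, (max ⟪w γ, w α⟫ 0) • γ with hp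
    have hv : w α = p - n := by
      conv_lhs => rw [expand (w α)]
      rw [hp, hn, ← Finset.sum_sub_distrib]
      apply Finset.sum_congr rfl
      intro γ _
      rw [← sub_smul]
      congr 1
      rcases le_total 0 ⟪w γ, w α⟫ with h | h
      · rw [max_eq_left h, max_eq_right (by linarith)]; ring
      · rw [max_eq_right h, max_eq_left (by linarith)]; ring
    have h1 : 0 ≤ ⟪w α, n⟫ := by
      rw [hn, inner_sum]
      apply Finset.sum_nonneg
      intro γ hγ
      rw [inner_smul_right]
      exact mul_nonneg (le_max_right _ _) (wpair α hα γ hγ)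
    have h2 : ⟪p, n⟫ ≤ 0 := by
      rw [hp, hn, sum_inner]
      apply Finset.sum_nonpos
      intro γ hγ
      rw [inner_sum]
      apply Finset.sum_nonpos
      intro δ hδ
      rw [inner_smul_left, inner_smul_right]
      simp only [conj_trivial]
      by_cases hgd : γ = δ
      · subst hgd
        rcases le_total 0 ⟪w γ, w α⟫ with h | h
        · rw [max_eq_right (a := -⟪w γ, w α⟫) (by linarith)]; simp
        · rw [max_eq_right h]; simp
      · exact mul_nonpos_of_nonneg_of_nonpos (le_max_right _ _)
          (mul_nonpos_of_nonneg_of_nonpos (le_max_right _ _) (obt γ hγ δ hδ hgd))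
    have h3 : ⟪n, n⟫ ≤ 0 := by
      rw [hv, inner_sub_left] at h1
      linarith
    have h4 : n = 0 := by
      apply inner_self_eq_zero (𝕜 := ℝ).1
      exact le_antisymm h3 real_inner_self_nonneg
    have h5 := key (fun γ => max (-⟪w γ, w α⟫) 0) β hβ
    rw [← hn, h4, inner_zero_right] at h5
    have h6 : -⟪w β, w α⟫ ≤ 0 := by
      have := le_max_left (-⟪w β, w α⟫) 0
      linarith
    rw [real_inner_comm]
    linarith
  refine ⟨nonneg, ?_⟩
  intro hirr α hα
  let s : Finset E := Δ.filter (fun β => 0 < ⟪w α, w β⟫)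
  have hαs : α ∈ s := by
    refine Finset.mem_filter.2 ⟨hα, real_inner_self_pos.2 ?_⟩
    intro h0
    have := hw α hα α hα
    rw [h0] at this
    simp at this
  by_cases hs : s = Δ
  · intro β hβ
    rw [← hs] at hβ
    exact (Finset.mem_filter.1 hβ).2
  · exfalso
    obtain ⟨β, hβ, γ, hγ, hne⟩ := hirr s (Finset.filter_subset _ _) ⟨α, hαs⟩ hs
    obtain ⟨hγΔ, hγs⟩ := Finset.mem_sdiff.1 hγ
    obtain ⟨hβΔ, hβpos⟩ := Finset.mem_filter.1 hβ
    have hneg : ⟪β, γ⟫ < (0 : ℝ) :=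
      lt_of_le_of_ne (obt β hβΔ γ hγΔ (fun h => hγs (h ▸ hβ))) hne
    have hlt : ⟪w α, γ⟫ < 0 := by
      rw [expand (w α), sum_inner]
      refine Finset.sum_neg' ?_ ⟨β, hβΔ, ?_⟩
      rotate_left
      · rw [inner_smul_left, real_inner_comm (w α) (w β)]
        simp only [conj_trivial]
        exact mul_neg_of_pos_of_neg hβpos hneg
      · intro δ hδ
        rw [inner_smul_left, real_inner_comm (w α) (w δ)]
        simp only [conj_trivial]
        by_cases hds : δ ∈ s
        · exact mul_nonpos_of_nonneg_of_nonpos (nonneg α hα δ hδ)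
            (obt δ hδ γ hγΔ (fun h => hγs (h ▸ hds)))
        · have h0 : ⟪w α, w δ⟫ = 0 := by
            apply le_antisymm _ (nonneg α hα δ hδ)
            by_contra hcon
            exact hds (Finset.mem_filter.2 ⟨hδ, not_le.1 hcon⟩)
          rw [h0]; simp
    exact absurd (wpair α hα γ hγΔ) (not_le.2 hlt)
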